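/- Case (i) of the proof of Theorem 1: In the GCQC setup, for any level i ∈ {1,…,m}, any u ∈ S_{A_i}^⊥ ∖ S_{A_i}, and any G ∈ S_I, the sum φ_i(u) + G has symplectic weight at least d_i D_i; i.e., multiplying a nontrivial level-i logical operator by any element of the block-wise inner stabilizer S_I does not reduce its weight below d_i D_i. -/

import Mathlib

open Finset

/-- Pauli operators (up to phase) on `n` qubits, as symplectic vectors. -/
abbrev Pauli (n : ℕ) := Fin n → (ZMod 2) × (ZMod 2)

/-- The outer space `W = (𝔽₂^r × 𝔽₂^r)^N`. -/
abbrev Outer (r N : ℕ) := Fin N → (Fin r → ZMod 2) × (Fin r → ZMod 2)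

/-- `N` blocks of `n` qubits each. -/
abbrev PauliB (n N : ℕ) := Fin N → Pauli n

/-- Elementary symplectic form on one qubit. -/
def B0 : LinearMap.BilinForm (ZMod 2) ((ZMod 2) × (ZMod 2)) :=
  LinearMap.mk₂ (ZMod 2) (fun u v => u.1 * v.2 + v.1 * u.2)
    (fun a b v => by simp; ring)
    (fun c a v => by simp; ring)
    (fun a b v => by simp; ring)
    (fun c a v => by simp; ring)

/-- Sum of a bilinear form over `N` coordinates. -/
def sumForm {M : Type*} [AddCommGroup M] [Module (ZMod 2) M] (N : ℕ)
    (B : LinearMap.BilinForm (ZMod 2) M) :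
    LinearMap.BilinForm (ZMod 2) (Fin N → M) :=
  LinearMap.mk₂ (ZMod 2) (fun u v => ∑ j, B (u j) (v j))
    (fun a b v => by simp [Finset.sum_add_distrib])
    (fun c a v => by simp [Finset.mul_sum])
    (fun a b v => by simp [Finset.sum_add_distrib])
    (fun c a v => by simp [Finset.mul_sum])

/-- Symplectic form on `r`-qubit blocks written as pairs of binary `r`-vectors. -/
def pairForm (r : ℕ) : LinearMap.BilinForm (ZMod 2) ((Fin r → ZMod 2) × (Fin r → ZMod 2)) :=
  LinearMap.mk₂ (ZMod 2) (fun u v => ∑ ℓ, (u.1 ℓ * v.2 ℓ + v.1 ℓ * u.2 ℓ))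
    (fun a b v => by rw [← Finset.sum_add_distrib]; refine Finset.sum_congr rfl fun ℓ _ => by simp; ring)
    (fun c a v => by rw [smul_eq_mul, Finset.mul_sum]; refine Finset.sum_congr rfl fun ℓ _ => by simp; ring)
    (fun a b v => by rw [← Finset.sum_add_distrib]; refine Finset.sum_congr rfl fun ℓ _ => by simp; ring)
    (fun c a v => by rw [smul_eq_mul, Finset.mul_sum]; refine Finset.sum_congr rfl fun ℓ _ => by simp; ring)

/-- Symplectic form on `Pauli n`. -/
def symplF (n : ℕ) : LinearMap.BilinForm (ZMod 2) (Pauli n) := sumForm n B0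

/-- Symplectic form on `N` blocks of `n` qubits. -/
def symplFB (n N : ℕ) : LinearMap.BilinForm (ZMod 2) (PauliB n N) := sumForm N (symplF n)

/-- Symplectic form on the outer space `W_i`. -/
def symplFO (r N : ℕ) : LinearMap.BilinForm (ZMod 2) (Outer r N) := sumForm N (pairForm r)

/-- Orthogonal complement of a subspace w.r.t. a bilinear form. -/
def perp {M : Type*} [AddCommGroup M] [Module (ZMod 2) M]
    (B : LinearMap.BilinForm (ZMod 2) M) (S : Submodule (ZMod 2) M) :
    Submodule (ZMod 2) M where
  carrier := {v | ∀ s ∈ S, B s v = 0}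
  add_mem' := fun hu hv s hs => by
    rw [map_add, hu s hs, hv s hs, add_zero]
  zero_mem' := fun s hs => by simp
  smul_mem' := fun c v hv s hs => by
    rw [map_smul, hv s hs, smul_zero]

/-- Generic weight: number of nonzero coordinates. -/
def wgt {N : ℕ} {M : Type*} [Zero M] [DecidableEq M] (v : Fin N → M) : ℕ :=
  (Finset.univ.filter fun j => v j ≠ 0).card

/-- Symplectic weight on `N` blocks of `n` qubits: number of nonzero qubit positions. -/
def swtB {n N : ℕ} (v : PauliB n N) : ℕ := ∑ j, wgt (v j)

/-- Stabilizer of the subcode `B_i`: `S` together with the logical `z`'s of index `< kk`. -/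
def Sstab (n : ℕ) (S : Submodule (ZMod 2) (Pauli n)) (z : ℕ → Pauli n) (kk : ℕ) :
    Submodule (ZMod 2) (Pauli n) :=
  S ⊔ Submodule.span (ZMod 2) (z '' Set.Iio kk)

/-- Span of the logical operators `x_t, z_t` with `a ≤ t < b` (0-based indexing). -/
def Lspan (n : ℕ) (x z : ℕ → Pauli n) (a b : ℕ) : Submodule (ZMod 2) (Pauli n) :=
  Submodule.span (ZMod 2) ((x '' Set.Ico a b) ∪ (z '' Set.Ico a b))

/-- The block-wise inner stabilizer `S_I`. -/
def SI (n N : ℕ) (S : Submodule (ZMod 2) (Pauli n)) : Submodule (ZMod 2) (PauliB n N) :=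
  Submodule.pi (Set.univ : Set (Fin N)) (fun _ => S)

/-- The replacement map `φ` with offset `off`, sending the `ℓ`-th binary coordinates of each
block to the logical operators `x (off+ℓ)`, `z (off+ℓ)` of the inner code. -/
def phi (n N : ℕ) (x z : ℕ → Pauli n) (off r : ℕ) :
    Outer r N →ₗ[ZMod 2] PauliB n N where
  toFun w := fun j =>
    (∑ ℓ : Fin r, (w j).1 ℓ • x (off + ℓ)) + (∑ ℓ : Fin r, (w j).2 ℓ • z (off + ℓ))
  map_add' := fun a b => by
    funext j
    simp [add_smul, Finset.sum_add_distrib]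
    abel
  map_smul' := fun c a => by
    funext j
    simp [mul_smul, Finset.smul_sum, smul_add]

theorem B0_comm (u v : ZMod 2 × ZMod 2) : B0 u v = B0 v u := by
  simp only [B0, LinearMap.mk₂_apply]
  ring

theorem symplF_comm {n : ℕ} (u v : Pauli n) : symplF n u v = symplF n v u := by
  simp only [symplF, sumForm, LinearMap.mk₂_apply]
  exact Finset.sum_congr rfl fun j _ => B0_comm _ _

theorem mem_perp_Sstab {n : ℕ} {S : Submodule (ZMod 2) (Pauli n)} {z : ℕ → Pauli n} {kk : ℕ}
    {v : Pauli n} (hS : v ∈ perp (symplF n) S) (hz : ∀ t < kk, symplF n (z t) v = 0) :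
    v ∈ perp (symplF n) (Sstab n S z kk) := by
  have hle : Sstab n S z kk ≤ LinearMap.ker ((symplF n).flip v) := by
    refine sup_le (fun s hs => hS s hs) (Submodule.span_le.2 ?_)
    rintro _ ⟨t, ht, rfl⟩
    exact hz t ht
  exact fun s hs => hle hs

theorem symplF_phi_apply {n N : ℕ} (x z : ℕ → Pauli n) (off r : ℕ) (u : Outer r N) (j : Fin N)
    (y : Pauli n) :
    symplF n y (phi n N x z off r u j) =
      ∑ ℓ : Fin r, (u j).1 ℓ * symplF n y (x (off + ℓ)) +
        ∑ ℓ : Fin r, (u j).2 ℓ * symplF n y (z (off + ℓ)) := by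
  simp [phi]

/-- If nonzero blocks of `u` give blocks of `v` of weight at least `d`, then the weights multiply. -/
theorem mul_wgt_le_swtB {n N d : ℕ} {M : Type*} [Zero M] [DecidableEq M] {u : Fin N → M}
    {v : PauliB n N} (h : ∀ j, u j ≠ 0 → d ≤ wgt (v j)) : d * wgt u ≤ swtB v := by
  calc d * wgt u = ∑ _j ∈ Finset.univ.filter fun j => u j ≠ 0, d := by
        simp [wgt, mul_comm]
    _ ≤ ∑ j ∈ Finset.univ.filter fun j => u j ≠ 0, wgt (v j) :=
        Finset.sum_le_sum fun j hj => h j (Finset.mem_filter.1 hj).2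
    _ ≤ swtB v := Finset.sum_le_sum_of_subset (Finset.filter_subset _ _)

/-- Logical operators of the levels from `off` on, times stabilizers, are logical operators
of the subcode with stabilizer `Sstab n S z off`. -/
theorem phi_apply_add_mem_perp_Sstab {n N k₁ off r : ℕ} {S : Submodule (ZMod 2) (Pauli n)}
    {x z : ℕ → Pauli n} (hoff : off + r ≤ k₁)
    (hSorth : S ≤ perp (symplF n) S)
    (hxS : ∀ t < k₁, x t ∈ perp (symplF n) S)
    (hzS : ∀ t < k₁, z t ∈ perp (symplF n) S)
    (hzz : ∀ s < k₁, ∀ t < k₁, symplF n (z s) (z t) = 0)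
    (hxz : ∀ s < k₁, ∀ t < k₁, symplF n (x s) (z t) = if s = t then 1 else 0)
    (u : Outer r N) (j : Fin N) {g : Pauli n} (hg : g ∈ S) :
    phi n N x z off r u j + g ∈ perp (symplF n) (Sstab n S z off) := by
  refine mem_perp_Sstab (add_mem (fun s hs => ?_) (hSorth hg)) fun t ht => ?_
  · rw [symplF_phi_apply, Finset.sum_eq_zero, Finset.sum_eq_zero, add_zero]
    · intro ℓ _
      rw [hzS _ (by omega) s hs, mul_zero]
    · intro ℓ _
      rw [hxS _ (by omega) s hs, mul_zero]
  · rw [map_add, symplF_comm _ g, hzS t (by omega) g hg, add_zero, symplF_phi_apply,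
      Finset.sum_eq_zero, Finset.sum_eq_zero, add_zero]
    · intro ℓ _
      rw [hzz _ (by omega) _ (by omega), mul_zero]
    · intro ℓ _
      rw [symplF_comm, hxz _ (by omega) _ (by omega), if_neg (by omega), mul_zero]

/-- The coordinates of `u j` are recovered as syndromes of its image under `phi`, so a nonzero
block is never mapped into the stabilizer `Sstab n S z off`, even after adding a stabilizer. -/
theorem phi_apply_add_notMem_Sstab {n N k₁ off r : ℕ} {S : Submodule (ZMod 2) (Pauli n)}
    {x z : ℕ → Pauli n} (hoff : off + r ≤ k₁)
    (hxS : ∀ t < k₁, x t ∈ perp (symplF n) S)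
    (hzS : ∀ t < k₁, z t ∈ perp (symplF n) S)
    (hxx : ∀ s < k₁, ∀ t < k₁, symplF n (x s) (x t) = 0)
    (hzz : ∀ s < k₁, ∀ t < k₁, symplF n (z s) (z t) = 0)
    (hxz : ∀ s < k₁, ∀ t < k₁, symplF n (x s) (z t) = if s = t then 1 else 0)
    (u : Outer r N) (j : Fin N) (huj : u j ≠ 0) {g : Pauli n} (hg : g ∈ S) :
    phi n N x z off r u j + g ∉ Sstab n S z off := by
  intro hmem
  have hzero : ∀ y ∈ perp (symplF n) S, (∀ t < off, symplF n (z t) y = 0) →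
      symplF n y (phi n N x z off r u j) = 0 := by
    intro y hy hyz
    have h := mem_perp_Sstab hy hyz _ hmem
    rwa [map_add, LinearMap.add_apply, hy g hg, add_zero, symplF_comm] at h
  refine huj (Prod.ext (funext fun ℓ => ?_) (funext fun ℓ => ?_))
  · have h := hzero (z (off + ℓ)) (hzS _ (by omega)) fun t ht => hzz _ (by omega) _ (by omega)
    rw [symplF_phi_apply, Finset.sum_eq_single ℓ, Finset.sum_eq_zero, symplF_comm,
      hxz _ (by omega) _ (by omega), if_pos rfl, mul_one, add_zero] at h
    · exact h
    · intro ℓ' _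
      rw [hzz _ (by omega) _ (by omega), mul_zero]
    · intro ℓ' _ hne
      rw [symplF_comm, hxz _ (by omega) _ (by omega),
        if_neg fun h => hne (Fin.ext (by omega)), mul_zero]
    · simp
  · have h := hzero (x (off + ℓ)) (hxS _ (by omega)) fun t ht => by
      rw [symplF_comm, hxz _ (by omega) _ (by omega), if_neg (by omega)]
    rw [symplF_phi_apply, Finset.sum_eq_zero, zero_add, Finset.sum_eq_single ℓ,
      hxz _ (by omega) _ (by omega), if_pos rfl, mul_one] at h
    · exact h
    · intro ℓ' _ hne
      rw [hxz _ (by omega) _ (by omega), if_neg fun h => hne (Fin.ext (by omega)), mul_zero]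
    · simp
    · intro ℓ' _
      rw [hxx _ (by omega) _ (by omega), mul_zero]

/-- Case (i) of the proof of Theorem 1: adding an element of the block-wise inner
stabilizer `S_I` to a nontrivial level-`i` logical operator keeps the weight `≥ d_i D_i`. -/
theorem gcqc_case_i
    (n N m : ℕ) (hm : 1 ≤ m)
    (k : ℕ → ℕ) (hk : ∀ i, 1 ≤ i → i ≤ m → k (i + 1) < k i) (hklast : k (m + 1) = 0)
    (hkn : k 1 ≤ n)
    (S : Submodule (ZMod 2) (Pauli n))
    (hSorth : S ≤ perp (symplF n) S)
    (hSdim : Module.finrank (ZMod 2) S = n - k 1)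
    (x z : ℕ → Pauli n)
    (hxS : ∀ t < k 1, x t ∈ perp (symplF n) S)
    (hzS : ∀ t < k 1, z t ∈ perp (symplF n) S)
    (hxx : ∀ s < k 1, ∀ t < k 1, symplF n (x s) (x t) = 0)
    (hzz : ∀ s < k 1, ∀ t < k 1, symplF n (z s) (z t) = 0)
    (hxz : ∀ s < k 1, ∀ t < k 1, symplF n (x s) (z t) = if s = t then 1 else 0)
    (hdual : perp (symplF n) S = S ⊔ Lspan n x z 0 (k 1))
    (hdisj : Disjoint S (Lspan n x z 0 (k 1)))
    (d : ℕ → ℕ)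
    (hd : ∀ i, 1 ≤ i → i ≤ m + 1 → ∀ v ∈ perp (symplF n) (Sstab n S z (k 1 - k i)),
      v ∉ Sstab n S z (k 1 - k i) → d i ≤ wgt v)
    (K D : ℕ → ℕ) (hKN : ∀ i, 1 ≤ i → i ≤ m → K i ≤ N)
    (SA : ∀ i : ℕ, Submodule (ZMod 2) (Outer (k i - k (i + 1)) N))
    (hSAorth : ∀ i, 1 ≤ i → i ≤ m → SA i ≤ perp (symplFO (k i - k (i + 1)) N) (SA i))
    (hSAdim : ∀ i, 1 ≤ i → i ≤ m →
      Module.finrank (ZMod 2) (SA i) = (k i - k (i + 1)) * (N - K i))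
    (hSAdist : ∀ i, 1 ≤ i → i ≤ m → ∀ w ∈ perp (symplFO (k i - k (i + 1)) N) (SA i),
      w ∉ SA i → D i ≤ wgt w)
    (i : ℕ) (h1i : 1 ≤ i) (him : i ≤ m)
    (u : Outer (k i - k (i + 1)) N)
    (hu : u ∈ perp (symplFO (k i - k (i + 1)) N) (SA i)) (hu' : u ∉ SA i)
    (G : PauliB n N) (hG : G ∈ SI n N S) :
    d i * D i ≤ swtB (phi n N x z (k 1 - k i) (k i - k (i + 1)) u + G) := by
  have hk1 : ∀ j, 1 ≤ j → j ≤ m → k j ≤ k 1 := by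
    intro j hj
    induction j, hj using Nat.le_induction with
    | base => exact fun _ => le_rfl
    | succ j hj ih => exact fun hjm => (hk j hj (by omega)).le.trans (ih (by omega))
  have hoff : k 1 - k i + (k i - k (i + 1)) ≤ k 1 := by
    have := hk1 i h1i him
    omega
  have hGS : ∀ j, G j ∈ S := fun j => hG j (Set.mem_univ j)
  exact (Nat.mul_le_mul_left _ (hSAdist i h1i him u hu hu')).trans <|
    mul_wgt_le_swtB fun j huj => hd i h1i (by omega) _
      (phi_apply_add_mem_perp_Sstab hoff hSorth hxS hzS hzz hxz u j (hGS j))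
      (phi_apply_add_notMem_Sstab hoff hxS hzS hxx hzz hxz u j huj (hGS j))
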